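/- Let p be a prime, k ≥ 1, and A an abelian group. For every c ∈ A^{⊗p^k}, the element τ_{k+1}^{-1}((N_{p^k}(c))^{⊗p}) of A^{⊗p^{k+1}} lies in the image of the norm map N_{p^{k+1}} = Σ_{s=0}^{p^{k+1}−1} σ_{k+1}^s. -/

import Mathlib

open scoped TensorProduct

section Digits

/-- Identification of digit tuples `(Fin p)^m` (first digit most significant) with `Fin (p^m)`
via base-`p` digits. -/
def msbEquiv (p m : ℕ) : (Fin m → Fin p) ≃ Fin (p ^ m) :=
  (Equiv.piCongrLeft' (fun _ => Fin p) Fin.revPerm).trans finFunctionFinEquiv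

/-- The digit rotation `τ_m : (i_1, …, i_m) ↦ (i_m, i_1, …, i_{m-1})` of digit tuples. -/
def rotPerm (p m : ℕ) [NeZero m] : Equiv.Perm (Fin m → Fin p) :=
  Equiv.piCongrLeft' (fun _ => Fin p) (Equiv.addRight (1 : Fin m))

/-- The permutation of `Fin (p^m)` corresponding to a permutation of digit tuples. -/
def digitPerm (p m : ℕ) (e : Equiv.Perm (Fin m → Fin p)) : Equiv.Perm (Fin (p ^ m)) :=
  Equiv.permCongr (msbEquiv p m) e

end Digits

noncomputable section Tensor

/-- The `m`-fold tensor power over `ℤ` of an abelian group `A`, indexed by `Fin m`. -/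
abbrev Tp (A : Type*) [AddCommGroup A] (m : ℕ) : Type _ := ⨂[ℤ] _ : Fin m, A

/-- The action of a permutation `e` of `Fin m` on the tensor power, by reindexing. -/
def permT (A : Type*) [AddCommGroup A] (m : ℕ) (e : Equiv.Perm (Fin m)) :
    Tp A m ≃ₗ[ℤ] Tp A m :=
  PiTensorProduct.reindex ℤ (fun _ : Fin m => A) e

/-- The cyclic permutation `σ_m` on the tensor power, induced by reindexing along
`x ↦ x + 1` on `Fin m`, so that `σ(a_1 ⊗ ⋯ ⊗ a_m) = a_m ⊗ a_1 ⊗ ⋯ ⊗ a_{m-1}`. -/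
def sigmaT (A : Type*) [AddCommGroup A] (m : ℕ) [NeZero m] : Tp A m ≃ₗ[ℤ] Tp A m :=
  permT A m (Equiv.addRight (1 : Fin m))

/-- The norm (transfer) map `N_m = Σ_{s=0}^{m-1} σ_m^s` on the tensor power. -/
def normT (A : Type*) [AddCommGroup A] (m : ℕ) [NeZero m] : Tp A m → Tp A m :=
  fun x => ∑ s ∈ Finset.range m, (⇑(sigmaT A m))^[s] x

/-- Identification of tensor powers of equal sizes. -/
def tcast {A : Type*} [AddCommGroup A] {a b : ℕ} (h : a = b) : Tp A a ≃ₗ[ℤ] Tp A b :=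
  TensorPower.cast ℤ A h

/-- Flattening of an iterated tensor power: `(A^{⊗N})^{⊗q} ≃ A^{⊗(N·q)}`, grouping
consecutive blocks of length `N`. -/
def flattenE (A : Type*) [AddCommGroup A] (N : ℕ) : (q : ℕ) →
    (⨂[ℤ] _ : Fin q, Tp A N) ≃ₗ[ℤ] Tp A (N * q)
  | 0 => (PiTensorProduct.isEmptyEquiv (Fin 0)).trans
      (PiTensorProduct.isEmptyEquiv (Fin 0)).symm
  | q + 1 =>
      (TensorPower.mulEquiv (R := ℤ) (M := Tp A N) (n := q) (m := 1)).symm.trans <|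
      (TensorProduct.congr (flattenE A N q)
        (PiTensorProduct.subsingletonEquiv (0 : Fin 1))).trans <|
      TensorPower.mulEquiv (R := ℤ) (M := A) (n := N * q) (m := N)

/-- The elementary tensor `c^{⊗B} ∈ A^{⊗(N·B)}` whose `B` consecutive blocks of length `N`
all equal `c ∈ A^{⊗N}`. -/
def tpow {A : Type*} [AddCommGroup A] {N : ℕ} (c : Tp A N) (B : ℕ) : Tp A (N * B) :=
  flattenE A N B (PiTensorProduct.tprod ℤ (fun _ : Fin B => c))

/-- `c^{⊗B}`, recast to live in `A^{⊗m}` along an identification `N * B = m`. -/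
def tpowTo {A : Type*} [AddCommGroup A] {N : ℕ} (c : Tp A N) (B : ℕ) {m : ℕ}
    (h : N * B = m) : Tp A m :=
  tcast (A := A) h (tpow c B)

end Tensor

section Orbits

lemma Equiv.Perm.sum_eq_sum_iterate {S M : Type*} [Fintype S] [AddCommMonoid M]
    (g : Equiv.Perm S) {m : ℕ} (hm : 0 < m) (hg : ∀ s, Function.minimalPeriod g s = m)
    (T : M →+ M) (F : S → M) (hF : ∀ s, F (g s) = T (F s)) :
    ∃ x, ∑ s, F s = ∑ j ∈ Finset.range m, T^[j] x := by
  classical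
  let r := Equiv.Perm.SameCycle.setoid g
  have hper (s : S) : Function.IsPeriodicPt g m s := hg s ▸ Function.isPeriodicPt_minimalPeriod g s
  have hFj (j : ℕ) (s : S) : F (g^[j] s) = T^[j] (F s) := by
    induction j with
    | zero => rfl
    | succ j ih => rw [Function.iterate_succ_apply', Function.iterate_succ_apply', hF, ih]
  refine ⟨∑ q : Quotient r, F q.out, ?_⟩
  have hT (j : ℕ) : T^[j] (∑ q : Quotient r, F q.out) = ∑ q : Quotient r, F (g^[j] q.out) := by
    simp_rw [hFj]
    induction j with
    | zero => rfl
    | succ j ih => simp only [Function.iterate_succ_apply', ih, map_sum]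
  simp_rw [hT]
  rw [← Finset.sum_product']
  symm
  refine Finset.sum_bij (fun x _ => g^[x.1] x.2.out) (fun _ _ => Finset.mem_univ _) ?_ ?_
    (fun _ _ => rfl)
  · rintro ⟨i, a⟩ hi ⟨j, b⟩ hj h
    simp only [Finset.mem_product, Finset.mem_range, Finset.mem_univ, and_true] at hi hj h
    have hab : a = b := by
      rw [← a.out_eq, ← b.out_eq]
      refine Quotient.sound (s := r) ?_
      change g.SameCycle a.out b.out
      rw [Equiv.Perm.iterate_eq_pow, Equiv.Perm.iterate_eq_pow] at h
      rw [← Equiv.Perm.sameCycle_pow_left (n := i), h, Equiv.Perm.sameCycle_pow_left]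
    subst hab
    have := Function.iterate_injOn_Iio_minimalPeriod (f := g) (x := a.out)
      (by simpa [hg] using hi) (by simpa [hg] using hj) h
    rw [this]
  · intro s _
    obtain ⟨n, hn⟩ := Equiv.Perm.SameCycle.exists_nat_pow_eq
      (show g.SameCycle (Quotient.mk r s).out s from Quotient.mk_out (s := r) s)
    refine ⟨(n % m, Quotient.mk r s), by simp [Nat.mod_lt _ hm], ?_⟩
    dsimp only
    rw [(hper _).iterate_mod_apply, Equiv.Perm.iterate_eq_pow, hn]

end Orbits

section TwistedRotation

variable {p : ℕ} [NeZero p] {R : Type*} [Ring R]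

/-- The extension of a `p`-tuple `s` to `ℤ` with `s (z + p) = s z - 1`. -/
def twistedExt (s : Fin p → R) (z : ℤ) : R :=
  s ⟨(z % p).toNat, by
    have := Int.emod_lt_of_pos z (Int.natCast_pos.2 (NeZero.pos p))
    have := Int.emod_nonneg z (Int.natCast_ne_zero.2 (NeZero.ne p))
    omega⟩ - ((z / p : ℤ) : R)

lemma twistedExt_add_mul (s : Fin p → R) (z q : ℤ) :
    twistedExt s (z + p * q) = twistedExt s z - q := by
  have hp : (p : ℤ) ≠ 0 := Int.natCast_ne_zero.2 (NeZero.ne p)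
  simp only [twistedExt, Int.add_mul_emod_self_left, Int.add_mul_ediv_left _ _ hp]
  push_cast
  abel

lemma twistedExt_val (s : Fin p → R) (b : Fin p) : twistedExt s (b : ℕ) = s b := by
  have h : (((b : ℕ) : ℤ) / p) = 0 := by
    exact_mod_cast Nat.div_eq_of_lt b.2
  simp only [twistedExt, h, Int.cast_zero, sub_zero]
  congr 1
  ext
  simp only [← Int.natCast_mod, Int.toNat_natCast, Nat.mod_eq_of_lt b.2]

/-- Rotation of a `p`-tuple by `j` places, adding `1` to an entry each time it wraps around. -/
def twistedRot (j : ℤ) (s : Fin p → R) : Fin p → R :=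
  fun b => twistedExt s ((b : ℕ) - j)

lemma twistedExt_twistedRot (j : ℤ) (s : Fin p → R) (z : ℤ) :
    twistedExt (twistedRot j s) z = twistedExt s (z - j) := by
  have hp : (p : ℤ) ≠ 0 := Int.natCast_ne_zero.2 (NeZero.ne p)
  have hz : z - j = (z % p - j) + p * (z / p) := by
    have := Int.emod_add_mul_ediv z p
    linarith
  rw [hz, twistedExt_add_mul, twistedExt, twistedRot]
  simp only [Int.toNat_of_nonneg (Int.emod_nonneg z hp)]

lemma twistedRot_twistedRot (i j : ℤ) (s : Fin p → R) :
    twistedRot i (twistedRot j s) = twistedRot (i + j) s := by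
  funext b
  rw [twistedRot, twistedExt_twistedRot, twistedRot]
  congr 1
  ring

lemma twistedRot_zero (s : Fin p → R) : twistedRot 0 s = s := by
  funext b
  rw [twistedRot, sub_zero, twistedExt_val]

lemma twistedRot_mul (j : ℤ) (s : Fin p → R) (b : Fin p) :
    twistedRot (p * j) s b = s b + j := by
  have h : ((b : ℕ) : ℤ) - p * j = (b : ℕ) + p * (-j) := by ring
  rw [twistedRot, h, twistedExt_add_mul, twistedExt_val]
  push_cast
  abel

lemma Fin.val_sub_one_eq_ite {n : ℕ} [NeZero n] (a : Fin n) :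
    ((a - 1 : Fin n) : ℕ) = if (a : ℕ) = 0 then n - 1 else (a : ℕ) - 1 := by
  obtain ⟨n, rfl⟩ := Nat.exists_eq_succ_of_ne_zero (NeZero.ne n)
  simp only [Fin.coe_sub_one, Fin.ext_iff, Fin.val_zero, Nat.succ_eq_add_one,
    Nat.add_sub_cancel]

lemma twistedRot_one (s : Fin p → R) (b : Fin p) :
    twistedRot 1 s b = if (b : ℕ) = 0 then s (b - 1) + 1 else s (b - 1) := by
  have hv := Fin.val_sub_one_eq_ite b
  rw [← twistedExt_val s (b - 1), hv, twistedRot]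
  have := NeZero.pos p
  split_ifs with h
  · have h' : ((b : ℕ) : ℤ) - 1 = ((p - 1 : ℕ) : ℤ) + p * (-1) := by
      push_cast [Nat.one_le_iff_ne_zero.2 (NeZero.ne p), h]
      ring
    rw [h', twistedExt_add_mul]
    simp
  · congr 1
    omega

/-- The twisted rotation by one place, as a permutation of `p`-tuples. -/
def twistedRotPerm (p : ℕ) [NeZero p] (R : Type*) [Ring R] : Equiv.Perm (Fin p → R) where
  toFun := twistedRot 1
  invFun := twistedRot (-1)
  left_inv s := by rw [twistedRot_twistedRot, neg_add_cancel, twistedRot_zero]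
  right_inv s := by rw [twistedRot_twistedRot, add_neg_cancel, twistedRot_zero]

lemma twistedRotPerm_iterate (n : ℕ) (s : Fin p → R) :
    (twistedRotPerm p R)^[n] s = twistedRot n s := by
  induction n with
  | zero => simp [twistedRot_zero]
  | succ n ih =>
    rw [Function.iterate_succ_apply', ih]
    change twistedRot 1 _ = _
    rw [twistedRot_twistedRot]
    push_cast
    rw [add_comm]

lemma minimalPeriod_twistedRotPerm (hp : p.Prime) {k : ℕ} (hk : 1 ≤ k)
    (s : Fin p → ZMod (p ^ k)) :
    Function.minimalPeriod (twistedRotPerm p (ZMod (p ^ k))) s = p ^ (k + 1) := by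
  have : Fact p.Prime := ⟨hp⟩
  refine Function.minimalPeriod_eq_prime_pow ?_ ?_
  · intro h
    obtain ⟨l, rfl⟩ := Nat.exists_eq_add_of_le' hk
    rw [Function.IsPeriodicPt, Function.IsFixedPt, twistedRotPerm_iterate,
      show ((p ^ (l + 1) : ℕ) : ℤ) = p * (p ^ l : ℕ) by push_cast; ring] at h
    have h0 := congrFun h 0
    rw [twistedRot_mul, add_eq_left, Int.cast_natCast, ZMod.natCast_eq_zero_iff] at h0
    exact absurd (Nat.le_of_dvd (pow_pos hp.pos l) h0)
      (not_le.2 (Nat.pow_lt_pow_right hp.one_lt (Nat.lt_succ_self l)))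
  · rw [Function.IsPeriodicPt, Function.IsFixedPt, twistedRotPerm_iterate,
      show ((p ^ (k + 1) : ℕ) : ℤ) = p * (p ^ k : ℕ) by push_cast; ring]
    funext b
    rw [twistedRot_mul, Int.cast_natCast, ZMod.natCast_self, add_zero]

end TwistedRotation

section DigitRotation

lemma Nat.sum_digits_div_mod {p : ℕ} (k : ℕ) (e : Fin (k + 1) → Fin p) :
    (∑ i, (e i : ℕ) * p ^ (i : ℕ)) = p * (∑ i : Fin k, (e i.succ : ℕ) * p ^ (i : ℕ)) + e 0 := by
  rw [Fin.sum_univ_succ, Finset.mul_sum, add_comm]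
  congr 1
  · refine Finset.sum_congr rfl fun i _ => ?_
    rw [Fin.val_succ, pow_succ]
    ring
  · simp

lemma digitPerm_rotPerm_val (p k : ℕ) [NeZero p] (y : Fin (p ^ (k + 1))) :
    (digitPerm p (k + 1) (rotPerm p (k + 1)) y : ℕ) = p ^ k * (y % p) + y / p := by
  obtain ⟨D, rfl⟩ := (msbEquiv p (k + 1)).surjective y
  have hval (D : Fin (k + 1) → Fin p) :
      (msbEquiv p (k + 1) D : ℕ) = ∑ i : Fin (k + 1), (D i.rev : ℕ) * p ^ (i : ℕ) := rfl
  have hrot (D : Fin (k + 1) → Fin p) (i : Fin (k + 1)) : rotPerm p (k + 1) D i = D (i - 1) := by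
    simp [rotPerm, sub_eq_add_neg]
  rw [digitPerm, Equiv.permCongr_apply, Equiv.symm_apply_apply, hval, hval,
    Nat.sum_digits_div_mod k fun i => D i.rev, Nat.mul_add_mod, Nat.mod_eq_of_lt (Fin.is_lt _),
    Nat.mul_add_div (NeZero.pos p), Nat.div_eq_of_lt (Fin.is_lt _), Fin.sum_univ_castSucc, add_comm]
  simp only [hrot]
  congr 1
  · rw [mul_comm]
    congr 3
    simp [Fin.ext_iff]
  · refine Finset.sum_congr rfl fun i _ => ?_
    refine congrArg (fun d => (D d : ℕ) * p ^ (i : ℕ)) ?_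
    rw [Fin.ext_iff, Fin.val_sub_one_eq_ite]
    have := i.2
    simp only [Fin.val_rev, Fin.val_castSucc, Fin.val_succ]
    split_ifs <;> omega

end DigitRotation

section TensorPowers

open PiTensorProduct

variable {A : Type*} [AddCommGroup A]

lemma mulEquiv_tprod {M : Type*} [AddCommGroup M] {a b : ℕ} (f : Fin a → M) (g : Fin b → M) :
    TensorPower.mulEquiv (R := ℤ) (tprod ℤ f ⊗ₜ[ℤ] tprod ℤ g) = tprod ℤ (Fin.append f g) :=
  TensorPower.tprod_mul_tprod ℤ f g

lemma flattenE_tprod {N : ℕ} (hN : 0 < N) (q : ℕ) (F : ℕ → ℕ → A) :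
    flattenE A N q (tprod ℤ fun b => tprod ℤ fun x : Fin N => F b x) =
      tprod ℤ fun y : Fin (N * q) => F (y / N) (y % N) := by
  induction q with
  | zero =>
    rw [flattenE, LinearEquiv.trans_apply, LinearEquiv.symm_apply_eq, isEmptyEquiv_apply_tprod,
      isEmptyEquiv_apply_tprod]
  | succ q ih =>
    have h : (tprod ℤ fun b : Fin (q + 1) => tprod ℤ fun x : Fin N => F b x) =
        TensorPower.mulEquiv (R := ℤ)
          ((tprod ℤ fun b : Fin q => tprod ℤ fun x : Fin N => F b x) ⊗ₜ[ℤ]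
            (tprod ℤ fun _ : Fin 1 => tprod ℤ fun x : Fin N => F q x)) := by
      rw [mulEquiv_tprod]
      congr 1
      funext b
      induction b using Fin.lastCases with
      | last =>
        rw [show Fin.last q = Fin.natAdd q (0 : Fin 1) from rfl, Fin.append_right]
        rfl
      | cast b =>
        rw [show b.castSucc = Fin.castAdd 1 b from rfl, Fin.append_left]
        rfl
    rw [h, flattenE, LinearEquiv.trans_apply, LinearEquiv.symm_apply_apply, LinearEquiv.trans_apply,
      TensorProduct.congr_tmul, ih, subsingletonEquiv_apply_tprod, mulEquiv_tprod]
    congr 1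
    funext y
    refine Fin.addCases (fun y => ?_) (fun y => ?_) y
    · rw [Fin.append_left]
      rfl
    · rw [Fin.append_right, Fin.val_natAdd, Nat.mul_add_div hN, Nat.mul_add_mod,
        Nat.mod_eq_of_lt y.2, Nat.div_eq_of_lt y.2, add_zero]

lemma permT_tprod {m : ℕ} (e : Equiv.Perm (Fin m)) (f : Fin m → A) :
    permT A m e (tprod ℤ f) = tprod ℤ fun i => f (e.symm i) :=
  reindex_tprod _ _

lemma sigmaT_tprod {m : ℕ} [NeZero m] (f : ℕ → A) :
    sigmaT A m (tprod ℤ fun i : Fin m => f i) =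
      tprod ℤ fun i : Fin m => f (if (i : ℕ) = 0 then m - 1 else (i : ℕ) - 1) := by
  rw [sigmaT, permT_tprod]
  simp_rw [← Fin.val_sub_one_eq_ite, sub_eq_add_neg]
  rfl

lemma sigmaT_iterate_card {m : ℕ} [NeZero m] (x : Tp A m) : (sigmaT A m)^[m] x = x := by
  have h (n : ℕ) (f : Fin m → A) :
      (sigmaT A m)^[n] (tprod ℤ f) = tprod ℤ fun i => f (i - n • (1 : Fin m)) := by
    induction n with
    | zero => simp
    | succ n ih =>
      rw [Function.iterate_succ_apply', ih, sigmaT, permT_tprod]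
      congr 1
      funext i
      congr 1
      simp [sub_eq_add_neg, succ_nsmul', add_assoc, add_comm]
  induction x using PiTensorProduct.induction_on with
  | smul_tprod r f =>
    have hs (n : ℕ) (x : Tp A m) : (sigmaT A m)^[n] (r • x) = r • (sigmaT A m)^[n] x := by
      induction n with
      | zero => rfl
      | succ n ih => simp only [Function.iterate_succ_apply', ih, map_smul]
    have hm : m • (1 : Fin m) = 0 := by
      simpa using card_nsmul_eq_zero (x := (1 : Fin m))
    rw [hs, h]
    congr 2
    funext i
    rw [hm, sub_zero]
  | add x y hx hy => rw [iterate_map_add, hx, hy]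

lemma sigmaT_iterate_val_add_one {N : ℕ} [NeZero N] (z : ZMod N) (c : Tp A N) :
    (sigmaT A N)^[(z + 1).val] c = sigmaT A N ((sigmaT A N)^[z.val] c) := by
  have hper : Function.IsPeriodicPt (sigmaT A N) N c := sigmaT_iterate_card c
  rw [← Function.iterate_succ_apply' (sigmaT A N), ← hper.iterate_mod_apply (z.val + 1), ZMod.val_add,
    ZMod.val_one_eq_one_mod, Nat.add_mod_mod]

lemma normT_eq_sum_zmod {N : ℕ} [NeZero N] (c : Tp A N) :
    normT A N c = ∑ z : ZMod N, (sigmaT A N)^[z.val] c := by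
  refine Finset.sum_nbij' (fun j => (j : ZMod N)) ZMod.val (by simp) ?_ ?_ (by simp) ?_
  · exact fun z _ => Finset.mem_range.2 z.val_lt
  · exact fun j hj => ZMod.val_cast_of_lt (Finset.mem_range.1 hj)
  · intro j hj
    rw [ZMod.val_cast_of_lt (Finset.mem_range.1 hj)]

variable (A) in
/-- The multilinear map sending `(d_b)_b` to `τ⁻¹(⨂_b d_b)`: position `p * x + b` of the value
carries the factor at position `x` of `d_b`. -/
noncomputable def interleave (p k : ℕ) [NeZero p] :
    MultilinearMap ℤ (fun _ : Fin p => Tp A (p ^ k)) (Tp A (p ^ (k + 1))) :=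
  ((permT A (p ^ (k + 1)) ((digitPerm p (k + 1) (rotPerm p (k + 1)))⁻¹)).toLinearMap ∘ₗ
    (tcast (pow_succ p k).symm).toLinearMap ∘ₗ
    (flattenE A (p ^ k) p).toLinearMap).compMultilinearMap (tprod ℤ)

lemma interleave_tprod (p k : ℕ) [NeZero p] (F : ℕ → ℕ → A) :
    interleave A p k (fun b => tprod ℤ fun x : Fin (p ^ k) => F b x) =
      tprod ℤ fun y : Fin (p ^ (k + 1)) => F (y % p) (y / p) := by
  have hN : 0 < p ^ k := pow_pos (NeZero.pos p) k
  change permT A _ _ (tcast (A := A) _ (flattenE A (p ^ k) p _)) = _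
  rw [flattenE_tprod hN, tcast, TensorPower.cast_tprod, permT_tprod]
  congr 1
  funext y
  have hy := digitPerm_rotPerm_val p k y
  have hlt : (y : ℕ) / p < p ^ k := Nat.div_lt_of_lt_mul (by rw [← pow_succ']; exact y.2)
  change F ((digitPerm p (k + 1) (rotPerm p (k + 1)) y : ℕ) / p ^ k)
    ((digitPerm p (k + 1) (rotPerm p (k + 1)) y : ℕ) % p ^ k) = _
  rw [hy, Nat.mul_add_div hN, Nat.mul_add_mod, Nat.mod_eq_of_lt hlt, Nat.div_eq_of_lt hlt, add_zero]

lemma span_range_tprod_nat (N : ℕ) :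
    Submodule.span ℤ (Set.range fun f : ℕ → A => tprod ℤ fun x : Fin N => f x) = ⊤ := by
  rw [← span_tprod_eq_top]
  congr 1
  refine Set.Subset.antisymm (Set.range_subset_iff.2 fun f => ⟨_, rfl⟩)
    (Set.range_subset_iff.2 fun f => ⟨fun n => if h : n < N then f ⟨n, h⟩ else 0, ?_⟩)
  simp

lemma sigmaT_interleave (p k : ℕ) [NeZero p] (d : Fin p → Tp A (p ^ k)) :
    sigmaT A (p ^ (k + 1)) (interleave A p k d) =
      interleave A p k fun b =>
        if (b : ℕ) = 0 then sigmaT A (p ^ k) (d (b - 1)) else d (b - 1) := by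
  let L : Fin p → Tp A (p ^ k) →ₗ[ℤ] Tp A (p ^ k) :=
    fun b => if (b : ℕ) = 0 then (sigmaT A (p ^ k)).toLinearMap else LinearMap.id
  let e : Fin p ≃ Fin p := Equiv.subRight 1
  suffices (sigmaT A (p ^ (k + 1))).toLinearMap.compMultilinearMap (interleave A p k) =
      ((interleave A p k).compLinearMap L).domDomCongr e by
    refine (DFunLike.congr_fun this d).trans ?_
    change interleave A p k (fun b => L b (d (b - 1))) = _
    congr 1
    funext b
    dsimp only [L]
    split_ifs <;> rfl
  refine MultilinearMap.ext_of_span_eq_top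
    (g := fun _ (f : ℕ → A) => tprod ℤ fun x : Fin (p ^ k) => f x)
    (fun _ => span_range_tprod_nat _) fun j => ?_
  change sigmaT A _ (interleave A p k fun b => tprod ℤ fun x : Fin (p ^ k) => j b x) =
    interleave A p k fun b => L b (tprod ℤ fun x : Fin (p ^ k) => j (b - 1) x)
  have hp : 0 < p := NeZero.pos p
  let F : ℕ → ℕ → A := fun b => if h : b < p then j ⟨b, h⟩ else 0
  have hF (b : Fin p) : j b = F b := by simp [F]
  let G : ℕ → ℕ → A := fun b x =>
    if b = 0 then F (p - 1) (if x = 0 then p ^ k - 1 else x - 1) else F (b - 1) x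
  have hG : (fun b : Fin p => L b (tprod ℤ fun x : Fin (p ^ k) => j (b - 1) x)) =
      fun b : Fin p => tprod ℤ fun x : Fin (p ^ k) => G b x := by
    funext b
    simp only [L, G, hF, Fin.val_sub_one_eq_ite]
    split_ifs with h
    · exact sigmaT_tprod _
    · rfl
  rw [hG]
  simp only [hF]
  rw [interleave_tprod, interleave_tprod,
    sigmaT_tprod (fun y => F (y % p) (y / p))]
  congr 1
  funext y
  dsimp only [G]
  have hdm := Nat.div_add_mod (y : ℕ) p
  have hmod := Nat.mod_lt (y : ℕ) hp
  generalize (y : ℕ) / p = a at *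
  generalize (y : ℕ) % p = r at *
  have key (n a r : ℕ) (hn : n = p * a + r) (hr : r < p) : n % p = r ∧ n / p = a := by
    subst hn
    rw [Nat.mul_add_mod, Nat.mul_add_div hp, Nat.mod_eq_of_lt hr, Nat.div_eq_of_lt hr]
    exact ⟨rfl, rfl⟩
  rw [← hdm]
  rcases Nat.eq_zero_or_pos r with rfl | hr
  · rcases Nat.eq_zero_or_pos a with rfl | ha
    · obtain ⟨h1, h2⟩ := key (p ^ (k + 1) - 1) (p ^ k - 1) (p - 1)
        (by
          have : 0 < p ^ k := pow_pos hp k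
          rw [pow_succ', Nat.mul_sub, mul_one]
          have : p * 1 ≤ p * p ^ k := Nat.mul_le_mul_left p this
          omega) (by omega)
      simp [h1, h2]
    · obtain ⟨h1, h2⟩ := key (p * a + 0 - 1) (a - 1) (p - 1)
        (by
          rw [Nat.mul_sub, mul_one]
          have : p * 1 ≤ p * a := Nat.mul_le_mul_left p ha
          omega) (by omega)
      have : p * a + 0 ≠ 0 := by positivity
      rw [if_neg this, h1, h2, if_pos rfl, if_neg ha.ne']
  · obtain ⟨h1, h2⟩ := key (p * a + r - 1) a (r - 1) (by omega) (by omega)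
    rw [if_neg (by omega), h1, h2, if_neg hr.ne']

end TensorPowers

/-- for a prime `p`, `k ≥ 1` and an abelian group `A`, for every
`c ∈ A^{⊗p^k}`, the element `τ_{k+1}⁻¹((N_{p^k}(c))^{⊗p})` of `A^{⊗p^{k+1}}` lies in the
image of the norm map `N_{p^{k+1}} = Σ_{s=0}^{p^{k+1}-1} σ_{k+1}^s`. -/
theorem statement5 (p : ℕ) [NeZero p] (hp : p.Prime) (k : ℕ) (hk : 1 ≤ k)
    (A : Type*) [AddCommGroup A] (c : Tp A (p ^ k)) :
    permT A (p ^ (k + 1)) ((digitPerm p (k + 1) (rotPerm p (k + 1)))⁻¹)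
        (tpowTo (normT A (p ^ k) c) p (pow_succ p k).symm)
      ∈ Set.range (normT A (p ^ (k + 1))) := by
  change interleave A p k (fun _ => normT A (p ^ k) c) ∈ _
  simp_rw [normT_eq_sum_zmod]
  rw [MultilinearMap.map_sum]
  obtain ⟨x, hx⟩ := (twistedRotPerm p (ZMod (p ^ k))).sum_eq_sum_iterate
    (pow_pos hp.pos (k + 1)) (minimalPeriod_twistedRotPerm hp hk)
    (sigmaT A (p ^ (k + 1))).toAddEquiv.toAddMonoidHom
    (fun s => interleave A p k fun b => (sigmaT A (p ^ k))^[(s b).val] c) (fun s => by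
      refine Eq.trans ?_ (sigmaT_interleave p k _).symm
      congr 1
      funext b
      change (sigmaT A (p ^ k))^[(twistedRot 1 s b).val] c = _
      rw [twistedRot_one]
      split_ifs
      · exact sigmaT_iterate_val_add_one _ c
      · rfl)
  exact ⟨x, hx.symm⟩
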